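/- Let M be a synchronous machine and T(M) the derived transition system described below. Then M does not satisfy Nondeducibility on Strategies (NDS) if and only if T(M) contains a path from q₀ = ({s₀},{{s₀}}) to a state (U, 𝒦) whose second component 𝒦 consists only of the empty set. -/

import Mathlib

/-- A synchronous machine (without the input-enabledness proof, which is
stated separately as `SyncMachine.InputEnabled`). -/
structure SyncMachine (S AH AL O : Type) where
  init : S
  trans : S → AH × AL → S → Prop
  obsH : S → O
  obsL : S → O

namespace SyncMachine

variable {S AH AL O : Type}

/-- The machine is input-enabled. -/
def InputEnabled (M : SyncMachine S AH AL O) : Prop :=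
  ∀ s a, ∃ t, M.trans s a t

/-- A step of a run: a joint action together with the resulting state. -/
abbrev Step (S AH AL : Type) := (AH × AL) × S

def IsRunFrom (M : SyncMachine S AH AL O) : S → List (Step S AH AL) → Prop
  | _, [] => True
  | s, (a, t) :: rest => M.trans s a t ∧ M.IsRunFrom t rest

/-- A run of the machine, starting at the initial state; represented as its
list of steps. -/
def IsRun (M : SyncMachine S AH AL O) (r : List (Step S AH AL)) : Prop :=
  M.IsRunFrom M.init r

/-- The final state of a run. -/
def final (M : SyncMachine S AH AL O) (r : List (Step S AH AL)) : S :=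
  r.foldl (fun _ st => st.2) M.init

/-- The sequence of `H` actions of a run. -/
def actH (r : List (Step S AH AL)) : List AH := r.map (fun st => st.1.1)

/-- The `H` view of a run: the initial `H` observation followed by the
alternating sequence of `H` actions and `H` observations. -/
def viewH (M : SyncMachine S AH AL O) (r : List (Step S AH AL)) : O × List (AH × O) :=
  (M.obsH M.init, r.map (fun st => (st.1.1, M.obsH st.2)))

/-- The `L` view of a run. -/
def viewL (M : SyncMachine S AH AL O) (r : List (Step S AH AL)) : O × List (AL × O) :=
  (M.obsL M.init, r.map (fun st => (st.1.2, M.obsL st.2)))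

/-- An `H` strategy: a map from (candidate) `H` views to `H` actions. -/
abbrev Strategy (AH O : Type) := O × List (AH × O) → AH

def ConsistentFrom (M : SyncMachine S AH AL O) (π : Strategy AH O) :
    O × List (AH × O) → List (Step S AH AL) → Prop
  | _, [] => True
  | v, (a, t) :: rest =>
      a.1 = π v ∧ M.ConsistentFrom π (v.1, v.2 ++ [(a.1, M.obsH t)]) rest

/-- A run is consistent with an `H` strategy `π` if each of its `H` actions is
the one prescribed by `π` on the `H` view of the preceding prefix of the run. -/
def Consistent (M : SyncMachine S AH AL O) (π : Strategy AH O)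
    (r : List (Step S AH AL)) : Prop :=
  M.ConsistentFrom π (M.obsH M.init, []) r

/-- `Run(M, π)`: the runs of `M` consistent with `π`. -/
def stratRuns (M : SyncMachine S AH AL O) (π : Strategy AH O) :
    Set (List (Step S AH AL)) :=
  { r | M.IsRun r ∧ M.Consistent π r }

/-- The set of `L` views of a set of runs. -/
def lviews (M : SyncMachine S AH AL O) (R : Set (List (Step S AH AL))) :
    Set (O × List (AL × O)) :=
  M.viewL '' R

/-- Nondeducibility on strategies. -/
def NDS (M : SyncMachine S AH AL O) : Prop :=
  ∀ π₁ π₂ : Strategy AH O, M.lviews (M.stratRuns π₁) = M.lviews (M.stratRuns π₂)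

/-- Nondeducibility on inputs. -/
def NDI (M : SyncMachine S AH AL O) : Prop :=
  ∀ r : List (Step S AH AL), M.IsRun r →
    ∀ α : List AH, α.length = r.length →
      ∃ r', M.IsRun r' ∧ actH r' = α ∧ M.viewL r' = M.viewL r

/-- A synchronous unwinding relation on `M`. -/
def Unwinding (M : SyncMachine S AH AL O) (R : S → S → Prop) : Prop :=
  Symmetric R ∧ R M.init M.init ∧
  (∀ s t, R s t → M.obsL s = M.obsL t) ∧
  (∀ s t, R s t → ∀ (a₁ a₂ : AH) (a₃ : AL) (s' : S), M.trans s (a₁, a₃) s' →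
    ∃ t', M.trans t (a₂, a₃) t' ∧ R s' t')

/-- Restrictiveness: there exists a synchronous unwinding relation. -/
def RES (M : SyncMachine S AH AL O) : Prop :=
  ∃ R, M.Unwinding R

end SyncMachine


namespace SyncMachine

variable {S AH AL O : Type}

/-- `δ_{a_H,o_H,a_L,o_L}(T)`. -/
def delta4 (M : SyncMachine S AH AL O) (aH : AH) (oH : O) (aL : AL) (oL : O)
    (T : Set S) : Set S :=
  { s | ∃ t ∈ T, M.trans t (aH, aL) s ∧ M.obsH s = oH ∧ M.obsL s = oL }

/-- `K(α, π, β)`: the set of final states of runs `r` consistent with `π`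
such that `view_H(r) = α` and `view_L(r)` is a prefix of `β`. -/
def Kstrat (M : SyncMachine S AH AL O) (π : Strategy AH O)
    (α : O × List (AH × O)) (β : O × List (AL × O)) : Set S :=
  { s | ∃ r, M.IsRun r ∧ M.Consistent π r ∧ M.viewH r = α ∧
        (M.viewL r).1 = β.1 ∧ (M.viewL r).2 <+: β.2 ∧ M.final r = s }

/-- The strategy `π` excludes the candidate `L` view `β` if no run consistent
with `π` has `L` view `β`. -/
def Excludes (M : SyncMachine S AH AL O) (π : Strategy AH O)
    (β : O × List (AL × O)) : Prop :=
  ¬ ∃ r, M.IsRun r ∧ M.Consistent π r ∧ M.viewL r = β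

end SyncMachine

namespace SyncMachine

variable {S AH AL O : Type}

/-- The transition relation of the system `T(M)`. -/
def tTrans (M : SyncMachine S AH AL O) :
    Set S × Set (Set S) → (Set S → AH) × AL × O → Set S × Set (Set S) → Prop :=
  fun q l q' =>
    q'.1 = { t | ∃ s ∈ q.1, ∃ aH' : AH, M.trans s (aH', l.2.1) t ∧ M.obsL t = l.2.2 } ∧
    q'.1.Nonempty ∧
    q'.2 = { k' | ∃ k ∈ q.2, ∃ oH : O, k' = M.delta4 (l.1 k) oH l.2.1 l.2.2 k }

end SyncMachine

namespace SyncMachine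

variable {S AH AL O : Type} (M : SyncMachine S AH AL O)

theorem isRunFrom_append_singleton (s : S) (r : List (Step S AH AL)) (x : Step S AH AL) :
    M.IsRunFrom s (r ++ [x]) ↔
      M.IsRunFrom s r ∧ M.trans (r.foldl (fun _ y => y.2) s) x.1 x.2 := by
  induction r generalizing s with
  | nil => simp [IsRunFrom]
  | cons y r ih => simp [IsRunFrom, ih, and_assoc]

theorem isRun_append_singleton (r : List (Step S AH AL)) (x : Step S AH AL) :
    M.IsRun (r ++ [x]) ↔ M.IsRun r ∧ M.trans (M.final r) x.1 x.2 :=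
  M.isRunFrom_append_singleton M.init r x

theorem final_append_singleton (r : List (Step S AH AL)) (x : Step S AH AL) :
    M.final (r ++ [x]) = x.2 := by
  simp [final]

theorem consistentFrom_append_singleton (π : Strategy AH O) (v : O × List (AH × O))
    (r : List (Step S AH AL)) (x : Step S AH AL) :
    M.ConsistentFrom π v (r ++ [x]) ↔
      M.ConsistentFrom π v r ∧
        x.1.1 = π (v.1, v.2 ++ r.map (fun y => (y.1.1, M.obsH y.2))) := by
  induction r generalizing v with
  | nil => simp [ConsistentFrom]
  | cons y r ih => simp [ConsistentFrom, ih, and_assoc]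

theorem consistent_append_singleton (π : Strategy AH O)
    (r : List (Step S AH AL)) (x : Step S AH AL) :
    M.Consistent π (r ++ [x]) ↔ M.Consistent π r ∧ x.1.1 = π (M.viewH r) := by
  simpa [Consistent, viewH] using M.consistentFrom_append_singleton π (M.obsH M.init, []) r x

/-- Consistency of a run depends only on the strategy at views shorter than the run. -/
theorem Consistent.congr {π π' : Strategy AH O} {r : List (Step S AH AL)}
    (h : M.Consistent π r) (hπ : ∀ v : O × List (AH × O), v.2.length < r.length → π v = π' v) :
    M.Consistent π' r := by
  induction r using List.reverseRecOn with
  | nil => trivial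
  | append_singleton r x ih =>
    rw [consistent_append_singleton] at h ⊢
    refine ⟨ih h.1 fun v hv => hπ v (by simp; omega), ?_⟩
    rw [h.2, hπ _ (by simp [viewH])]

/-- The strategy `π`, with the action at views of length `n` replaced by the one given by `f`. -/
def Strategy.updateAt (π : Strategy AH O) (n : ℕ) (f : List (AH × O) → AH) :
    Strategy AH O :=
  fun v => if v.2.length = n then f v.2 else π v

theorem Strategy.updateAt_of_length_eq (π : Strategy AH O) {n : ℕ} (f : List (AH × O) → AH)
    {v : O × List (AH × O)} (hv : v.2.length = n) : π.updateAt n f v = f v.2 :=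
  if_pos hv

theorem consistent_updateAt_iff (π : Strategy AH O) (f : List (AH × O) → AH)
    {n : ℕ} {r : List (Step S AH AL)} (hr : r.length = n) :
    M.Consistent (Strategy.updateAt π n f) r ↔ M.Consistent π r := by
  have h (v : O × List (AH × O)) (hv : v.2.length < r.length) :
      Strategy.updateAt π n f v = π v := if_neg (by omega)
  exact ⟨fun hc => hc.congr M h, fun hc => hc.congr M fun v hv => (h v hv).symm⟩

theorem exists_strategy_consistent [Nonempty AH] (r : List (Step S AH AL)) :
    ∃ π : Strategy AH O, M.Consistent π r := by
  induction r using List.reverseRecOn with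
  | nil => exact ⟨fun _ => Classical.arbitrary AH, trivial⟩
  | append_singleton r x ih =>
    obtain ⟨π, hπ⟩ := ih
    refine ⟨Strategy.updateAt π r.length fun _ => x.1.1,
      (M.consistent_append_singleton _ _ _).2 ⟨(M.consistent_updateAt_iff π _ rfl).2 hπ, ?_⟩⟩
    rw [Strategy.updateAt_of_length_eq _ _ (by simp [viewH])]

/-- A reachable state `(U, 𝒦)` of `T(M)` comes with an `L` view and a strategy such that every
state of `U` is reached by a run with that view, while the runs consistent with the strategy
having that view and a given `H` view all end in one member of `𝒦`. -/
theorem exists_strategy_of_reach [Nonempty AH] {q : Set S × Set (Set S)}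
    (hq : Relation.ReflTransGen (fun q q' => ∃ l, M.tTrans q l q') ({M.init}, {{M.init}}) q) :
    q.1.Nonempty ∧ ∃ (β : List (AL × O)) (π : Strategy AH O),
      (∀ u ∈ q.1, ∃ r, M.IsRun r ∧ (M.viewL r).2 = β ∧ M.final r = u) ∧
      ∀ α, ∃ k ∈ q.2, ∀ r, M.IsRun r → M.Consistent π r →
        (M.viewH r).2 = α → (M.viewL r).2 = β → M.final r ∈ k := by
  induction hq with
  | refl =>
    refine ⟨⟨M.init, rfl⟩, [], fun _ => Classical.arbitrary AH, ?_, ?_⟩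
    · rintro u rfl
      exact ⟨[], trivial, rfl, rfl⟩
    · refine fun α => ⟨{M.init}, rfl, fun r _ _ _ hr => ?_⟩
      obtain rfl : r = [] := by simpa [viewL] using hr
      rfl
  | @tail q q' _ hstep ih =>
    obtain ⟨⟨ρ, aL, oL⟩, hU, hne, hK⟩ := hstep
    obtain ⟨-, β, π, hβ, hπ⟩ := ih
    choose f hf hrun using hπ
    refine ⟨hne, β ++ [(aL, oL)], Strategy.updateAt π β.length fun α => ρ (f α), ?_, ?_⟩
    · intro u hu
      rw [hU] at hu
      obtain ⟨s, hs, aH, htr, ho⟩ := hu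
      obtain ⟨r, hr, hv, rfl⟩ := hβ s hs
      refine ⟨r ++ [((aH, aL), u)], (M.isRun_append_singleton _ _).2 ⟨hr, htr⟩, ?_,
        M.final_append_singleton _ _⟩
      simpa [viewL, ho] using hv
    · intro α
      rw [hK]
      induction α using List.reverseRecOn with
      | nil =>
        refine ⟨_, ⟨f [], hf [], M.obsH M.init, rfl⟩, fun r _ _ hvH hvL => ?_⟩
        obtain rfl : r = [] := by simpa [viewH] using hvH
        simp [viewL] at hvL
      | append_singleton α y _ =>
        refine ⟨_, ⟨f α, hf α, y.2, rfl⟩, fun r hr hc hvH hvL => ?_⟩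
        induction r using List.reverseRecOn with
        | nil => simp [viewL] at hvL
        | append_singleton r x _ =>
          obtain ⟨hα, rfl⟩ : (M.viewH r).2 = α ∧ (x.1.1, M.obsH x.2) = y := by
            simpa [viewH] using hvH
          obtain ⟨hβr, hx⟩ : (M.viewL r).2 = β ∧ (x.1.2, M.obsL x.2) = (aL, oL) := by
            simpa [viewL] using hvL
          obtain ⟨haL, hoL⟩ := Prod.mk.inj hx
          have hlen : r.length = β.length := by simp [← hβr, viewL]
          rw [consistent_append_singleton, M.consistent_updateAt_iff π _ hlen,
            Strategy.updateAt_of_length_eq _ _ (by simpa [viewH] using hlen), hα] at hc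
          rw [isRun_append_singleton] at hr
          rw [final_append_singleton]
          refine ⟨M.final r, hrun α r hr.1 hc.1 hα hβr, ?_, rfl, hoL⟩
          simpa only [← hc.2, ← haL] using hr.2

/-- Along any run, `T(M)` reaches a state `(U, 𝒦)` such that `U` contains the final state of the
run, and every member of `𝒦` consists of final states of runs consistent with `π` with one common
`H` view and the `L` view of the given run. -/
theorem exists_reach_of_isRun (π : Strategy AH O) {r : List (Step S AH AL)} (hr : M.IsRun r) :
    ∃ q : Set S × Set (Set S),
      Relation.ReflTransGen (fun q q' => ∃ l, M.tTrans q l q') ({M.init}, {{M.init}}) q ∧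
      M.final r ∈ q.1 ∧
      ∀ k ∈ q.2, ∃ α, ∀ s ∈ k, ∃ r', M.IsRun r' ∧ M.Consistent π r' ∧
        M.viewH r' = α ∧ M.viewL r' = M.viewL r ∧ M.final r' = s := by
  induction r using List.reverseRecOn with
  | nil =>
    refine ⟨_, .refl, rfl, ?_⟩
    rintro k rfl
    refine ⟨M.viewH ([] : List (Step S AH AL)), ?_⟩
    rintro s rfl
    exact ⟨[], trivial, trivial, rfl, rfl, rfl⟩
  | append_singleton r x ih =>
    rw [isRun_append_singleton] at hr
    obtain ⟨q, hq, hU, hK⟩ := ih hr.1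
    have : Nonempty (O × List (AH × O)) := ⟨(M.obsH M.init, [])⟩
    choose! α hα using hK
    have hmem : x.2 ∈ {t | ∃ s ∈ q.1, ∃ aH, M.trans s (aH, x.1.2) t ∧ M.obsL t = M.obsL x.2} :=
      ⟨_, hU, x.1.1, hr.2, rfl⟩
    refine ⟨(_, _), hq.tail ⟨(fun k => π (α k), x.1.2, M.obsL x.2), rfl, ⟨x.2, hmem⟩, rfl⟩, ?_, ?_⟩
    · rwa [final_append_singleton]
    · rintro _ ⟨k, hk, oH, rfl⟩
      refine ⟨((α k).1, (α k).2 ++ [(π (α k), oH)]), ?_⟩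
      rintro s ⟨t, ht, htr, rfl, hoL⟩
      obtain ⟨r', hr', hc, hvH, hvL, rfl⟩ := hα k hk t ht
      refine ⟨r' ++ [((π (α k), x.1.2), s)], (M.isRun_append_singleton _ _).2 ⟨hr', htr⟩,
        (M.consistent_append_singleton _ _ _).2 ⟨hc, by rw [hvH]⟩, ?_, ?_,
        M.final_append_singleton _ _⟩
      · simp [← hvH, viewH]
      · simpa [viewL, hoL] using hvL

end SyncMachine

open SyncMachine in
/-- Lemma 4: `M ∉ NDS` iff `T(M)` contains a path from
`q₀ = ({s₀},{{s₀}})` to a state `(U,𝒦)` where `𝒦` consists only of the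
empty set. -/
theorem not_nds_iff_tm_reach {S AH AL O : Type}
    (M : SyncMachine S AH AL O) (hM : M.InputEnabled) :
    ¬ M.NDS ↔
      ∃ q : Set S × Set (Set S),
        Relation.ReflTransGen (fun q q' => ∃ l, M.tTrans q l q')
          ({M.init}, {{M.init}}) q ∧
        ∀ k ∈ q.2, k = (∅ : Set S) := by
  constructor
  · intro h
    obtain ⟨π₁, π₂, hsub⟩ : ∃ π₁ π₂ : Strategy AH O,
        ¬ M.lviews (M.stratRuns π₁) ⊆ M.lviews (M.stratRuns π₂) := by
      by_contra! hall
      exact h fun π₁ π₂ => (hall π₁ π₂).antisymm (hall π₂ π₁)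
    obtain ⟨_, ⟨r, hr, rfl⟩, hnot⟩ := Set.not_subset.1 hsub
    obtain ⟨q, hq, -, hK⟩ := M.exists_reach_of_isRun π₂ hr.1
    refine ⟨q, hq, fun k hk => Set.eq_empty_of_forall_notMem fun s hs => hnot ?_⟩
    obtain ⟨α, hα⟩ := hK k hk
    obtain ⟨r', hr', hc, -, hvL, -⟩ := hα s hs
    exact ⟨r', ⟨hr', hc⟩, hvL⟩
  · rintro ⟨q, hq, hK⟩ hnds
    have hAH : Nonempty AH := by
      rcases hq.cases_head with rfl | ⟨_, ⟨l, -⟩, -⟩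
      · exact absurd (hK _ rfl) (Set.singleton_ne_empty _)
      · exact ⟨l.1 ∅⟩
    obtain ⟨⟨u, hu⟩, β, π, hβ, hπ⟩ := M.exists_strategy_of_reach hq
    obtain ⟨r, hr, hv, -⟩ := hβ u hu
    obtain ⟨π', hπ'⟩ := M.exists_strategy_consistent r
    have hmem : M.viewL r ∈ M.lviews (M.stratRuns π) :=
      hnds π' π ▸ ⟨r, ⟨hr, hπ'⟩, rfl⟩
    obtain ⟨r', ⟨hr', hc'⟩, hvr'⟩ := hmem
    obtain ⟨k, hk, hend⟩ := hπ (M.viewH r').2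
    have hfin := hend r' hr' hc' rfl (hvr' ▸ hv)
    rw [hK k hk] at hfin
    exact hfin
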